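/- arXiv:0809.1298 — 8 statements merged into one kernel-verified Lean document; each statement's English description precedes it below -/
import Mathlib

section
/- Let I ⊆ ℝ be an open interval and let k : ℝ → ℝ be three times continuously differentiable on I. If k satisfies the system k''' + k' = 0 and 3k'' + k(3 + k²) = 0 on I, then k ≡ 0 on I. -/
/-- Let `I = (a, b) ⊆ ℝ` be an open interval and let `k : ℝ → ℝ` be three times
continuously differentiable on `I` (with first, second and third derivatives
`k1`, `k2`, `k3` on `I`, the third one continuous).  If `k` satisfies
`k''' + k' = 0` and `3 k'' + k (3 + k²) = 0` on `I`, then `k ≡ 0` on `I`. -/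
theorem no_cones_in_R3_with_proper_biharmonic_Gauss_map
    (a b : ℝ) (k k1 k2 k3 : ℝ → ℝ)
    (h1 : ∀ x ∈ Set.Ioo a b, HasDerivAt k (k1 x) x)
    (h2 : ∀ x ∈ Set.Ioo a b, HasDerivAt k1 (k2 x) x)
    (h3 : ∀ x ∈ Set.Ioo a b, HasDerivAt k2 (k3 x) x)
    (hc : ContinuousOn k3 (Set.Ioo a b))
    (ode1 : ∀ x ∈ Set.Ioo a b, k3 x + k1 x = 0)
    (ode2 : ∀ x ∈ Set.Ioo a b, 3 * k2 x + k x * (3 + (k x) ^ 2) = 0) :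
    ∀ x ∈ Set.Ioo a b, k x = 0 := by
  intro x hx
  have deriv_eq_zero : ∀ {f : ℝ → ℝ} {f' y : ℝ}, HasDerivAt f f' y →
      (∀ᶠ z in nhds y, f z = 0) → f' = 0 := fun hf h0 =>
    hf.unique ((hasDerivAt_const _ (0 : ℝ)).congr_of_eventuallyEq h0)
  have sq_mul_k1 : ∀ y ∈ Set.Ioo a b, k y ^ 2 * k1 y = 0 := by
    intro y hy
    have hd := ((h3 y hy).const_mul 3).add
      ((h1 y hy).mul (((h1 y hy).pow 2).const_add 3))
    have h := deriv_eq_zero hd (Filter.mem_of_superset (isOpen_Ioo.mem_nhds hy) ode2)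
    simp only [Pi.pow_apply] at h
    norm_num at h
    linear_combination (1 / 3) * h - ode1 y hy
  by_contra hk
  have k1_zero : ∀ᶠ y in nhds x, k1 y = 0 := by
    filter_upwards [(h1 x hx).continuousAt.eventually_ne hk, isOpen_Ioo.mem_nhds hx] with y hy hyI
    exact (mul_eq_zero.mp (sq_mul_k1 y hyI)).resolve_left (pow_ne_zero 2 hy)
  have h := ode2 x hx
  rw [deriv_eq_zero (h2 x hx) k1_zero, mul_zero, zero_add] at h
  exact mul_ne_zero hk (by positivity) h
end

section
/- The equation 6x⁶ − 45x⁴ + 60x² − 1 = 0 has exactly two distinct real roots in the interval (√3/3, ∞), and both of these roots are different from √3. -/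
/-- Vieta's formula for the product of three distinct roots of `6t³ − 45t² + 60t − 1`. -/
theorem cubic_roots_prod {a b c : ℝ} (hab : a ≠ b) (hca : c ≠ a) (hcb : c ≠ b)
    (ha : 6 * a ^ 3 - 45 * a ^ 2 + 60 * a - 1 = 0)
    (hb : 6 * b ^ 3 - 45 * b ^ 2 + 60 * b - 1 = 0)
    (hc : 6 * c ^ 3 - 45 * c ^ 2 + 60 * c - 1 = 0) : 6 * (a * b * c) = 1 := by
  have h1 : 6 * (a ^ 2 + a * b + b ^ 2) - 45 * (a + b) + 60 = 0 :=
    mul_left_cancel₀ (sub_ne_zero.2 hab) (by linear_combination ha - hb)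
  have h2 : 6 * (a ^ 2 + a * c + c ^ 2) - 45 * (a + c) + 60 = 0 :=
    mul_left_cancel₀ (sub_ne_zero.2 hca) (by linear_combination hc - ha)
  have h3 : 6 * (a + b + c) - 45 = 0 :=
    mul_left_cancel₀ (sub_ne_zero.2 hcb) (by linear_combination h2 - h1)
  linear_combination ha - a * h1 + a * b * h3


/-- The equation `6x⁶ − 45x⁴ + 60x² − 1 = 0` has exactly two distinct real roots
in the interval `(√3/3, ∞)`, and both of these roots are different from `√3`. -/
theorem poly_l3_q2_two_roots :
    ∃ x y : ℝ, x ≠ y ∧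
      x > Real.sqrt 3 / 3 ∧ y > Real.sqrt 3 / 3 ∧
      6 * x ^ 6 - 45 * x ^ 4 + 60 * x ^ 2 - 1 = 0 ∧
      6 * y ^ 6 - 45 * y ^ 4 + 60 * y ^ 2 - 1 = 0 ∧
      x ≠ Real.sqrt 3 ∧ y ≠ Real.sqrt 3 ∧
      ∀ z : ℝ, z > Real.sqrt 3 / 3 →
        6 * z ^ 6 - 45 * z ^ 4 + 60 * z ^ 2 - 1 = 0 → z = x ∨ z = y := by
  have hcont : Continuous fun x : ℝ => 6 * x ^ 6 - 45 * x ^ 4 + 60 * x ^ 2 - 1 := by fun_prop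
  obtain ⟨x, ⟨hx1, hx2⟩, hx⟩ := intermediate_value_Icc' (a := (1 : ℝ)) (b := 3 / 2)
    (by norm_num) hcont.continuousOn (show (0 : ℝ) ∈ _ by constructor <;> norm_num)
  obtain ⟨y, ⟨hy1, hy2⟩, hy⟩ := intermediate_value_Icc (a := (2 : ℝ)) (b := 3)
    (by norm_num) hcont.continuousOn (show (0 : ℝ) ∈ _ by constructor <;> norm_num)
  have hs : √3 ^ 2 = (3 : ℝ) := Real.sq_sqrt (by norm_num)
  have hs0 : 0 ≤ √3 := Real.sqrt_nonneg 3
  have hs3 : √3 / 3 < 1 := by nlinarith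
  have hne : ∀ w : ℝ, 6 * w ^ 6 - 45 * w ^ 4 + 60 * w ^ 2 - 1 = 0 → w ≠ √3 := by
    rintro w hw rfl
    rw [show √3 ^ 6 = (√3 ^ 2) ^ 3 by ring, show √3 ^ 4 = (√3 ^ 2) ^ 2 by ring, hs] at hw
    norm_num at hw
  refine ⟨x, y, by linarith, by linarith, by linarith, hx, hy, hne x hx, hne y hy,
    fun z hz hz0 => ?_⟩
  have hzpos : 0 < z := by linarith
  by_contra! h
  have hprod := cubic_roots_prod (a := x ^ 2) (b := y ^ 2) (c := z ^ 2)
    (fun e => by nlinarith)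
    (fun e => h.1 ((sq_eq_sq₀ hzpos.le (by linarith)).1 e))
    (fun e => h.2 ((sq_eq_sq₀ hzpos.le (by linarith)).1 e))
    (by linear_combination hx) (by linear_combination hy) (by linear_combination hz0)
  have hz2 : 1 / 3 < z ^ 2 := by nlinarith
  have hxy : 1 ≤ x ^ 2 * y ^ 2 := one_le_mul_of_one_le_of_one_le (by nlinarith) (by nlinarith)
  nlinarith
end

section
/- The equation 4x⁶ − 33x⁴ + 42x² − 1 = 0 has exactly two distinct real roots in the interval (√3/3, ∞), and both of these roots are different from √3. -/
/-- By Vieta's formulas, three distinct roots of `4t³ − 33t² + 42t − 1` have product `1/4`. -/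
lemma four_mul_mul_mul_eq_one_of_cubic_roots {a b c : ℝ} (hab : a ≠ b) (hac : a ≠ c) (hbc : b ≠ c)
    (ha : 4 * a ^ 3 - 33 * a ^ 2 + 42 * a - 1 = 0)
    (hb : 4 * b ^ 3 - 33 * b ^ 2 + 42 * b - 1 = 0)
    (hc : 4 * c ^ 3 - 33 * c ^ 2 + 42 * c - 1 = 0) : 4 * (a * b * c) = 1 := by
  have h₁ : 4 * (a ^ 2 + a * b + b ^ 2) - 33 * (a + b) + 42 = 0 :=
    mul_left_cancel₀ (sub_ne_zero.2 hab) (by linear_combination ha - hb)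
  have h₂ : 4 * (a ^ 2 + a * c + c ^ 2) - 33 * (a + c) + 42 = 0 :=
    mul_left_cancel₀ (sub_ne_zero.2 hac) (by linear_combination ha - hc)
  have h₃ : 4 * (a + b + c) - 33 = 0 :=
    mul_left_cancel₀ (sub_ne_zero.2 hbc) (by linear_combination h₁ - h₂)
  linear_combination a * b * h₃ + ha - a * h₁

/-- The equation `4x⁶ − 33x⁴ + 42x² − 1 = 0` has exactly two distinct real roots
in the interval `(√3/3, ∞)`, and both of these roots are different from `√3`. -/
theorem poly_l3_q3_two_roots :
    ∃ x y : ℝ, x ≠ y ∧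
      x > Real.sqrt 3 / 3 ∧ y > Real.sqrt 3 / 3 ∧
      4 * x ^ 6 - 33 * x ^ 4 + 42 * x ^ 2 - 1 = 0 ∧
      4 * y ^ 6 - 33 * y ^ 4 + 42 * y ^ 2 - 1 = 0 ∧
      x ≠ Real.sqrt 3 ∧ y ≠ Real.sqrt 3 ∧
      ∀ z : ℝ, z > Real.sqrt 3 / 3 →
        4 * z ^ 6 - 33 * z ^ 4 + 42 * z ^ 2 - 1 = 0 → z = x ∨ z = y := by
  have hs : Real.sqrt 3 ^ 2 = 3 := Real.sq_sqrt (by norm_num)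
  have hs₁ : 3 / 2 < Real.sqrt 3 := Real.lt_sqrt_of_sq_lt (by norm_num)
  have hs₂ : Real.sqrt 3 < 2 := (Real.sqrt_lt' (by norm_num)).2 (by norm_num)
  have hcont : Continuous fun x : ℝ => 4 * x ^ 6 - 33 * x ^ 4 + 42 * x ^ 2 - 1 := by fun_prop
  obtain ⟨x, ⟨hx₁, hx₂⟩, hx⟩ := intermediate_value_Ioo' (a := (1 : ℝ)) (b := 3 / 2) (by norm_num)
    hcont.continuousOn (show (0 : ℝ) ∈ _ by constructor <;> norm_num)
  obtain ⟨y, ⟨hy₁, hy₂⟩, hy⟩ := intermediate_value_Ioo (a := (2 : ℝ)) (b := 3) (by norm_num)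
    hcont.continuousOn (show (0 : ℝ) ∈ _ by constructor <;> norm_num)
  dsimp only at hx hy
  refine ⟨x, y, by linarith, by linarith, by linarith, hx, hy, by linarith, by linarith, ?_⟩
  intro z hz hz0
  by_contra! hne
  have hzpos : 0 < z := by linarith
  have sq_ne {u v : ℝ} (hu : 0 < u) (hv : 0 < v) (huv : u ≠ v) : u ^ 2 ≠ v ^ 2 :=
    fun h => huv ((sq_eq_sq₀ hu.le hv.le).1 h)
  have key := four_mul_mul_mul_eq_one_of_cubic_roots
    (sq_ne (u := x) (v := y) (by linarith) (by linarith) (by linarith))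
    (sq_ne (by linarith) hzpos hne.1.symm) (sq_ne (by linarith) hzpos hne.2.symm)
    (by linear_combination hx) (by linear_combination hy) (by linear_combination hz0)
  have hx2 : 1 < x ^ 2 := by nlinarith
  have hy2 : 4 < y ^ 2 := by nlinarith
  have hz2 : 1 / 3 < z ^ 2 := by nlinarith
  have hxy : 4 < x ^ 2 * y ^ 2 := by nlinarith
  nlinarith
end

section
/- For q ∈ {0, 1, 2, 3}, there exists a real number x with x > √3/3 and x ≠ √3 satisfying 2^q·(9x⁶ + 45x² + 6) = 3(3·2^q − 2)·(1 − 3x²)² if and only if q = 2 or q = 3. -/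
/-- If `m ≥ 4`, the equation `m (9x⁶ + 45x² + 6) = 3 (3m − 2) (1 − 3x²)²` has a solution in
the interval `[1, 3/2]`. -/
theorem exists_mem_Icc_sextic_eq {m : ℝ} (hm : 4 ≤ m) :
    ∃ x ∈ Set.Icc (1 : ℝ) (3 / 2),
      m * (9 * x ^ 6 + 45 * x ^ 2 + 6) = 3 * (3 * m - 2) * (1 - 3 * x ^ 2) ^ 2 := by
  have hf : ContinuousOn (fun x : ℝ => m * (9 * x ^ 6 + 45 * x ^ 2 + 6) -
      3 * (3 * m - 2) * (1 - 3 * x ^ 2) ^ 2) (Set.Icc 1 (3 / 2)) := by fun_prop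
  obtain ⟨x, hx, h⟩ := intermediate_value_Icc' (by norm_num) hf
    (show (0 : ℝ) ∈ Set.Icc _ _ from ⟨by norm_num; linarith, by norm_num; linarith⟩)
  exact ⟨x, hx, sub_eq_zero.mp h⟩

/-- For `q ∈ {0, 1, 2, 3}`, there exists a real number `x` with `x > √3/3` and
`x ≠ √3` satisfying `2^q (9x⁶ + 45x² + 6) = 3 (3·2^q − 2) (1 − 3x²)²` if and
only if `q = 2` or `q = 3`. -/
theorem isoparametric_type3_hypercone_biharmonic_Gauss_iff (q : ℕ) (hq : q ≤ 3) :
    (∃ x : ℝ, x > Real.sqrt 3 / 3 ∧ x ≠ Real.sqrt 3 ∧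
        (2 : ℝ) ^ q * (9 * x ^ 6 + 45 * x ^ 2 + 6) =
          3 * (3 * (2 : ℝ) ^ q - 2) * (1 - 3 * x ^ 2) ^ 2) ↔
      q = 2 ∨ q = 3 := by
  constructor
  · rintro ⟨x, hx, hx3, h⟩
    have hx0 : 0 < x := lt_trans (by positivity) hx
    by_contra! hne
    obtain rfl | rfl : q = 0 ∨ q = 1 := by lia
    · have hpos : 0 < 9 * x ^ 2 * ((x ^ 2 - 3 / 2) ^ 2 + 19 / 4) + 3 := by positivity
      linarith
    · have hprod : x ^ 2 * (x ^ 2 - 3) ^ 2 = 0 := by linarith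
      have hsq : x ^ 2 = 3 := by
        simpa [hx0.ne', sub_eq_zero] using hprod
      exact hx3 (by rw [← hsq, Real.sqrt_sq hx0.le])
  · intro hq'
    have hm : (4 : ℝ) ≤ 2 ^ q := by
      rcases hq' with rfl | rfl <;> norm_num
    obtain ⟨x, ⟨hx1, hx2⟩, h⟩ := exists_mem_Icc_sextic_eq hm
    have hlt : Real.sqrt 3 < 3 := by
      rw [Real.sqrt_lt' (by norm_num)]; norm_num
    have hgt : 3 / 2 < Real.sqrt 3 := Real.lt_sqrt_of_sq_lt (by norm_num)
    exact ⟨x, by linarith, (hx2.trans_lt hgt).ne, h⟩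
end

section
/- The polynomial x¹² − 12x¹⁰ + 135x⁸ − 216x⁶ + 135x⁴ − 12x² + 1 has no real roots. -/
/-- The polynomial `x¹² − 12x¹⁰ + 135x⁸ − 216x⁶ + 135x⁴ − 12x² + 1` has no real
roots. -/
theorem poly_l6_m1_no_real_roots :
    ∀ x : ℝ, x ^ 12 - 12 * x ^ 10 + 135 * x ^ 8 - 216 * x ^ 6 + 135 * x ^ 4
      - 12 * x ^ 2 + 1 ≠ 0 := by
  intro x
  have sum_of_squares : x ^ 12 - 12 * x ^ 10 + 135 * x ^ 8 - 216 * x ^ 6 + 135 * x ^ 4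
      - 12 * x ^ 2 + 1 = ((x ^ 2 - 1) * ((x ^ 2 - 1) ^ 2 - 3 * x ^ 2)) ^ 2
        + 87 * (x ^ 2 * (x ^ 2 - 1)) ^ 2 + 32 * (x ^ 3) ^ 2 := by ring
  rcases eq_or_ne x 0 with rfl | hx
  · norm_num
  · rw [sum_of_squares]
    positivity
end

section
/- The polynomial 3x¹² − 45x¹⁰ + 465x⁸ − 766x⁶ + 465x⁴ − 45x² + 3 has no real roots. -/
/-- The polynomial `3x¹² − 45x¹⁰ + 465x⁸ − 766x⁶ + 465x⁴ − 45x² + 3` has no real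
roots. -/
theorem poly_l6_m2_no_real_roots :
    ∀ x : ℝ, 3 * x ^ 12 - 45 * x ^ 10 + 465 * x ^ 8 - 766 * x ^ 6
      + 465 * x ^ 4 - 45 * x ^ 2 + 3 ≠ 0 := by
  intro x
  rcases eq_or_ne x 0 with rfl | hx
  · norm_num
  have key : 3 * x ^ 12 - 45 * x ^ 10 + 465 * x ^ 8 - 766 * x ^ 6
      + 465 * x ^ 4 - 45 * x ^ 2 + 3
      = (x ^ 2 - 1) ^ 2 * (3 * ((x ^ 2 - 1) ^ 2 - 9 / 2 * x ^ 2) ^ 2 + 1005 / 4 * x ^ 4)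
        + 80 * x ^ 6 := by
    ring
  rw [key]
  positivity
end

section
/- Let m > 3 be an integer and set D = √(9m² − 40m + 40). Then 9m² − 40m + 40 > 0, and for either choice of sign, the numbers r₁² = (3m − 4 ± D)/(2(4m − 6)) and r₂² = (5m − 8 ∓ D)/(2(4m − 6)) satisfy: r₁² > 0, r₂² > 0, r₁² + r₂² = 1, 1/r₁² + (m − 1)/r₂² = 4m − 6, and 1/r₁² ≠ (m − 1)/r₂². -/
/-- Let `m > 3` be an integer and set `D = √(9m² − 40m + 40)`.  Then
`9m² − 40m + 40 > 0`, and for either choice of sign `s = ±1`, the numbers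
`r₁² = (3m − 4 + sD)/(2(4m − 6))` and `r₂² = (5m − 8 − sD)/(2(4m − 6))` satisfy
`r₁² > 0`, `r₂² > 0`, `r₁² + r₂² = 1`, `1/r₁² + (m − 1)/r₂² = 4m − 6`, and
`1/r₁² ≠ (m − 1)/r₂²`. -/
theorem generalized_torus_hypercone_radii (m : ℤ) (hm : 3 < m)
    (s : ℝ) (hs : s = 1 ∨ s = -1) :
    9 * (m : ℝ) ^ 2 - 40 * (m : ℝ) + 40 > 0 ∧
    ((3 * (m : ℝ) - 4 + s * Real.sqrt (9 * (m : ℝ) ^ 2 - 40 * (m : ℝ) + 40)) /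
        (2 * (4 * (m : ℝ) - 6)) > 0 ∧
      (5 * (m : ℝ) - 8 - s * Real.sqrt (9 * (m : ℝ) ^ 2 - 40 * (m : ℝ) + 40)) /
        (2 * (4 * (m : ℝ) - 6)) > 0 ∧
      (3 * (m : ℝ) - 4 + s * Real.sqrt (9 * (m : ℝ) ^ 2 - 40 * (m : ℝ) + 40)) /
          (2 * (4 * (m : ℝ) - 6)) +
        (5 * (m : ℝ) - 8 - s * Real.sqrt (9 * (m : ℝ) ^ 2 - 40 * (m : ℝ) + 40)) /
          (2 * (4 * (m : ℝ) - 6)) = 1 ∧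
      1 / ((3 * (m : ℝ) - 4 + s * Real.sqrt (9 * (m : ℝ) ^ 2 - 40 * (m : ℝ) + 40)) /
          (2 * (4 * (m : ℝ) - 6))) +
        ((m : ℝ) - 1) /
          ((5 * (m : ℝ) - 8 - s * Real.sqrt (9 * (m : ℝ) ^ 2 - 40 * (m : ℝ) + 40)) /
            (2 * (4 * (m : ℝ) - 6))) = 4 * (m : ℝ) - 6 ∧
      1 / ((3 * (m : ℝ) - 4 + s * Real.sqrt (9 * (m : ℝ) ^ 2 - 40 * (m : ℝ) + 40)) /
          (2 * (4 * (m : ℝ) - 6))) ≠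
        ((m : ℝ) - 1) /
          ((5 * (m : ℝ) - 8 - s * Real.sqrt (9 * (m : ℝ) ^ 2 - 40 * (m : ℝ) + 40)) /
            (2 * (4 * (m : ℝ) - 6)))) := by
  have hM : (4 : ℝ) ≤ m := by exact_mod_cast hm
  generalize (m : ℝ) = M at hM ⊢
  have hD : 9 * M ^ 2 - 40 * M + 40 > 0 := by nlinarith
  have ht : (s * √(9 * M ^ 2 - 40 * M + 40)) ^ 2 = 9 * M ^ 2 - 40 * M + 40 := by
    rw [mul_pow, Real.sq_sqrt hD.le]
    rcases hs with rfl | rfl <;> ring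
  generalize s * √(9 * M ^ 2 - 40 * M + 40) = t at ht ⊢
  obtain ⟨ht₁, ht₂⟩ := abs_lt_of_sq_lt_sq' (show t ^ 2 < (3 * M - 4) ^ 2 by nlinarith)
    (by linarith)
  have hN : 0 < 4 * M - 6 := by linarith
  have hx : 0 < 3 * M - 4 + t := by linarith
  have hy : 0 < 5 * M - 8 - t := by linarith
  refine ⟨hD, by positivity, by positivity, ?_, ?_, fun h => ?_⟩
  · rw [← add_div, div_eq_one_iff_eq (mul_pos two_pos hN).ne']
    ring
  · rw [one_div_div, div_div_eq_mul_div, div_add_div _ _ hx.ne' hy.ne',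
      div_eq_iff (mul_pos hx hy).ne']
    linear_combination (4 * M - 6) * ht
  · rw [one_div_div, div_div_eq_mul_div, div_eq_div_iff hx.ne' hy.ne'] at h
    have hxy : 5 * M - 8 - t = (M - 1) * (3 * M - 4 + t) := by
      apply mul_left_cancel₀ (mul_pos two_pos hN).ne'
      linear_combination h
    have hMt : M * t = -3 * (M - 2) ^ 2 := by linear_combination -hxy
    have hroots : (M - 1) * (2 * M - 3) * (M - 3) = 0 := by
      linear_combination (M * t - 3 * (M - 2) ^ 2) / 16 * hMt - M ^ 2 / 16 * ht
    have h₁ : 0 < M - 1 := by linarith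
    have h₂ : 0 < 2 * M - 3 := by linarith
    have h₃ : 0 < M - 3 := by linarith
    exact (mul_pos (mul_pos h₁ h₂) h₃).ne' hroots
end

section
/- Let n > 2 be a real number. (i) For every θ ∈ (0, π/2) with cot²θ = (√n + √2)/(√n − √2) or cot²θ = (√n − √2)/(√n + √2), one has sin²2θ = (n − 2)/n. (ii) The number x = (n − 2)/n does not satisfy (4n − 3)x² − (6n − 11)x + 2(n − 2) = 0; in fact (4n − 3)x² − (6n − 11)x + 2(n − 2) = 6(n − 2)/n² > 0 for this x. -/
theorem sin_two_mul_sq_of_cot_sq_eq_div {θ p q : ℝ} (hs : Real.sin θ ≠ 0) (hq : q ≠ 0)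
    (hpq : q + p ≠ 0) (h : Real.cot θ ^ 2 = p / q) :
    Real.sin (2 * θ) ^ 2 = 4 * (q * p) / (q + p) ^ 2 := by
  rw [Real.cot_eq_cos_div_sin, div_pow, div_eq_div_iff (pow_ne_zero 2 hs) hq] at h
  have hc : Real.cos θ ^ 2 = p / (q + p) := by
    rw [eq_div_iff hpq]
    linear_combination h + p * Real.sin_sq_add_cos_sq θ
  have hs' : Real.sin θ ^ 2 = q / (q + p) := by
    rw [eq_div_iff hpq]
    linear_combination q * Real.sin_sq_add_cos_sq θ - h
  rw [Real.sin_two_mul, mul_pow, mul_pow, hs', hc]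
  field_simp
  ring


/-- Let `n > 2` be a real number.
(i) For every `θ ∈ (0, π/2)` with `cot²θ = (√n + √2)/(√n − √2)` or
`cot²θ = (√n − √2)/(√n + √2)`, one has `sin²(2θ) = (n − 2)/n`.
(ii) The number `x = (n − 2)/n` does not satisfy
`(4n − 3)x² − (6n − 11)x + 2(n − 2) = 0`; in fact the left-hand side equals
`6(n − 2)/n² > 0` for this `x`. -/
theorem takagi_minimal_and_biharmonic_exclusive (n : ℝ) (hn : 2 < n) :
    (∀ θ : ℝ, θ ∈ Set.Ioo 0 (Real.pi / 2) →
      (Real.cot θ ^ 2 = (Real.sqrt n + Real.sqrt 2) / (Real.sqrt n - Real.sqrt 2) ∨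
        Real.cot θ ^ 2 = (Real.sqrt n - Real.sqrt 2) / (Real.sqrt n + Real.sqrt 2)) →
      Real.sin (2 * θ) ^ 2 = (n - 2) / n) ∧
    ((4 * n - 3) * ((n - 2) / n) ^ 2 - (6 * n - 11) * ((n - 2) / n)
        + 2 * (n - 2) = 6 * (n - 2) / n ^ 2 ∧
      6 * (n - 2) / n ^ 2 > 0) := by
  have hn0 : 0 < n := by linarith
  have ha0 : 0 < Real.sqrt n := Real.sqrt_pos.2 hn0
  have hb0 : 0 < Real.sqrt 2 := Real.sqrt_pos.2 two_pos
  have hab : 0 < Real.sqrt n - Real.sqrt 2 :=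
    sub_pos.2 (Real.sqrt_lt_sqrt zero_le_two hn)
  have ha2 : Real.sqrt n ^ 2 = n := Real.sq_sqrt hn0.le
  have hb2 : Real.sqrt 2 ^ 2 = 2 := Real.sq_sqrt zero_le_two
  have hsum : (Real.sqrt n - Real.sqrt 2) + (Real.sqrt n + Real.sqrt 2) ≠ 0 := by
    linarith
  have hratio : 4 * ((Real.sqrt n - Real.sqrt 2) * (Real.sqrt n + Real.sqrt 2)) /
      ((Real.sqrt n - Real.sqrt 2) + (Real.sqrt n + Real.sqrt 2)) ^ 2 = (n - 2) / n := by
    rw [show (Real.sqrt n - Real.sqrt 2) * (Real.sqrt n + Real.sqrt 2) = n - 2 by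
        linear_combination ha2 - hb2,
      show ((Real.sqrt n - Real.sqrt 2) + (Real.sqrt n + Real.sqrt 2)) ^ 2 = 4 * n by
        linear_combination 4 * ha2]
    exact mul_div_mul_left _ _ four_ne_zero
  refine ⟨fun θ hθ h => ?_, ?_, ?_⟩
  · have hs : Real.sin θ ≠ 0 :=
      (Real.sin_pos_of_pos_of_lt_pi hθ.1 (by linarith [hθ.2, Real.pi_pos])).ne'
    rw [← hratio]
    rcases h with h | h
    · exact sin_two_mul_sq_of_cot_sq_eq_div hs hab.ne' hsum h
    · rw [sin_two_mul_sq_of_cot_sq_eq_div hs (by positivity) (by rwa [add_comm]) h]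
      ring
  · field_simp
    ring
  · have : 0 < n - 2 := by linarith
    positivity
end
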